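/- For all t ∈ (0,1), K ≥ 1 and C ≥ 1, the function H(t) = tanh((C/2)·max{2·artanh(t), (2·artanh(t))^{1/K}}) satisfies H(t) ≤ C·t^{1/K}. -/

import Mathlib

/-- The inverse hyperbolic tangent on `(-1, 1)`: `artanh t = (1/2) log((1+t)/(1-t))`. -/
noncomputable def artanh (t : ℝ) : ℝ := (1 / 2) * Real.log ((1 + t) / (1 - t))

theorem Real.hasDerivAt_tanh (x : ℝ) : HasDerivAt Real.tanh (1 / Real.cosh x ^ 2) x := by
  have h := (Real.hasDerivAt_sinh x).div (Real.hasDerivAt_cosh x) (Real.cosh_pos x).ne'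
  have hfun : Real.tanh = Real.sinh / Real.cosh := by
    funext y
    simp [Real.tanh_eq_sinh_div_cosh]
  rwa [← sq, ← sq, Real.cosh_sq_sub_sinh_sq, ← hfun] at h

theorem Real.tanh_mul_le_mul_tanh {c x : ℝ} (hc : 1 ≤ c) (hx : 0 ≤ x) :
    Real.tanh (c * x) ≤ c * Real.tanh x := by
  have hderiv (y : ℝ) : HasDerivAt (fun y ↦ c * Real.tanh y - Real.tanh (c * y))
      (c * (1 / Real.cosh y ^ 2) - 1 / Real.cosh (c * y) ^ 2 * (c * 1)) y :=
    ((Real.hasDerivAt_tanh y).const_mul c).sub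
      ((Real.hasDerivAt_tanh (c * y)).comp y ((hasDerivAt_id y).const_mul c))
  have hmono : MonotoneOn (fun y ↦ c * Real.tanh y - Real.tanh (c * y)) (Set.Ici 0) := by
    refine monotoneOn_of_deriv_nonneg (convex_Ici 0)
      (fun y _ ↦ (hderiv y).continuousAt.continuousWithinAt)
      (fun y _ ↦ (hderiv y).differentiableAt.differentiableWithinAt) fun y hy ↦ ?_
    rw [interior_Ici, Set.mem_Ioi] at hy
    rw [(hderiv y).deriv]
    have hcosh : Real.cosh y ≤ Real.cosh (c * y) := by
      rw [Real.cosh_le_cosh, abs_of_pos hy, abs_of_pos (by positivity)]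
      nlinarith
    have hle : 1 / Real.cosh (c * y) ^ 2 ≤ 1 / Real.cosh y ^ 2 := by
      have := Real.cosh_pos y
      gcongr
    nlinarith
  have h := hmono Set.self_mem_Ici hx hx
  simp only [mul_zero, Real.tanh_zero, sub_zero] at h
  linarith

theorem tanh_artanh {t : ℝ} (ht : t ∈ Set.Ioo (-1 : ℝ) 1) : Real.tanh (artanh t) = t := by
  have h := Real.artanh_eq_half_log (Set.Ioo_subset_Icc_self ht)
  rw [artanh, ← h, Real.tanh_artanh ht]

theorem le_two_mul_artanh {t : ℝ} (ht : t ∈ Set.Ico (0 : ℝ) 1) : t ≤ 2 * artanh t := by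
  obtain ⟨h0, h1⟩ := ht
  have hpos : 0 < (1 + t) / (1 - t) := div_pos (by linarith) (by linarith)
  have hlog := Real.one_sub_inv_le_log_of_pos hpos
  have hle : t ≤ 1 - ((1 + t) / (1 - t))⁻¹ := by
    rw [inv_div, le_sub_iff_add_le, ← le_sub_iff_add_le', div_le_iff₀ (by linarith)]
    nlinarith
  rw [artanh]
  linarith

theorem stmt_18 (t C K : ℝ) (ht : t ∈ Set.Ioo (0 : ℝ) 1) (hK : 1 ≤ K) (hC : 1 ≤ C) :
    Real.tanh ((C / 2) * max (2 * artanh t) ((2 * artanh t) ^ (1 / K))) ≤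
      C * t ^ (1 / K) := by
  obtain ⟨h0, h1⟩ := ht
  have htanh : Real.tanh (artanh t) = t := tanh_artanh ⟨by linarith, h1⟩
  have htu : t ≤ 2 * artanh t := le_two_mul_artanh ⟨h0.le, h1⟩
  have ha1 : 1 / K ≤ 1 := (div_le_one (by linarith)).2 hK
  generalize 1 / K = a at *
  set u := 2 * artanh t with hu
  have hu0 : 0 < u := h0.trans_le htu
  set v := max u (u ^ a)
  have hc : 1 ≤ C * (v / u) :=
    one_le_mul_of_one_le_of_one_le hC ((one_le_div hu0).2 (le_max_left _ _))
  have hbound : v * (t / u) ≤ t ^ a := by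
    rcases max_choice u (u ^ a) with h | h
    · rw [show v = u from h, mul_div_cancel₀ _ hu0.ne']
      exact Real.self_le_rpow_of_le_one h0.le h1.le ha1
    · calc v * (t / u) = u ^ a * (t / u) := by rw [show v = u ^ a from h]
        _ ≤ u ^ a * (t / u) ^ a := by
          gcongr
          exact Real.self_le_rpow_of_le_one (by positivity) ((div_le_one hu0).2 htu) ha1
        _ = t ^ a := by
          rw [← Real.mul_rpow hu0.le (by positivity), mul_div_cancel₀ _ hu0.ne']
  calc Real.tanh (C / 2 * v) = Real.tanh (C * (v / u) * artanh t) := by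
        congr 1
        rw [show artanh t = u / 2 by rw [hu]; ring]
        field_simp
    _ ≤ C * (v / u) * Real.tanh (artanh t) := Real.tanh_mul_le_mul_tanh hc (by linarith)
    _ = C * (v * (t / u)) := by rw [htanh]; ring
    _ ≤ C * t ^ a := by gcongr
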